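/- Let δ ≥ 0, let C > 100δ, and let C' ≥ 0. There exists a constant C₁ (depending only on δ, C and C') with the following property: whenever X is a geodesic metric space that is δ-hyperbolic in the sense of Gromov, φ₁ and φ₂ are isometries of X whose almost fixed sets F_C(φ₁) and F_C(φ₂) are nonempty and whose quasiconvex hulls 𝒳_C(φ₁) and 𝒳_C(φ₂) each have diameter at most C', and the distance between 𝒳_C(φ₁) and 𝒳_C(φ₂) is at least C₁, then every element w of the subgroup ⟨φ₁, φ₂⟩ of isometries of X that is not conjugate within ⟨φ₁, φ₂⟩ to a power of φ₁ or to a power of φ₂ acts loxodromically on X; that is, for every x ∈ X there exist constants a > 0 and b ≥ 0 such that d(wⁿ x, x) ≥ a·n − b for all integers n ≥ 1. -/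

import Mathlib

/-! Common definitions: geodesic segments, geodesic metric spaces, Gromov hyperbolicity,
almost fixed sets of isometries, quasiconvex hulls, set distance, quasiconvexity. -/

variable {X : Type*}

/-- `γ` is an arclength (isometric) parametrization of a geodesic from `x` to `y`,
defined on the interval `[0, dist x y]`. -/
def GeodesicParam [MetricSpace X] (γ : ℝ → X) (x y : X) : Prop :=
  γ 0 = x ∧ γ (dist x y) = y ∧
    ∀ s ∈ Set.Icc (0 : ℝ) (dist x y), ∀ t ∈ Set.Icc (0 : ℝ) (dist x y),
      dist (γ s) (γ t) = |s - t|

/-- `s` is a geodesic segment joining `x` to `y`. -/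
def IsGeodSegment [MetricSpace X] (s : Set X) (x y : X) : Prop :=
  ∃ γ : ℝ → X, GeodesicParam γ x y ∧ s = γ '' Set.Icc (0 : ℝ) (dist x y)

/-- A geodesic metric space: any two points are joined by a geodesic segment. -/
def IsGeodesicSpace (X : Type*) [MetricSpace X] : Prop :=
  ∀ x y : X, ∃ s : Set X, IsGeodSegment s x y

/-- The Gromov product `(x, y)_p`. -/
noncomputable def gromovProd [MetricSpace X] (p x y : X) : ℝ :=
  (dist p x + dist p y - dist x y) / 2

/-- `X` is δ-hyperbolic in the sense of Gromov: the Gromov product condition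
`(x, y)_p ≥ min ((x, z)_p, (z, y)_p) − δ` holds for all points. -/
def IsGromovHyperbolic (X : Type*) [MetricSpace X] (δ : ℝ) : Prop :=
  ∀ p x y z : X, min (gromovProd p x z) (gromovProd p z y) ≤ gromovProd p x y + δ

/-- The distance between two subsets of a metric space. -/
noncomputable def setDist [MetricSpace X] (A B : Set X) : ℝ :=
  sInf (Set.image2 dist A B)

/-- The almost fixed set `F_C(φ)` of an isometry `φ`. -/
def almostFixedSet [MetricSpace X] (φ : X ≃ᵢ X) (C : ℝ) : Set X :=
  {x | ∃ n : ℤ, n ≠ 0 ∧ dist x ((φ ^ n) x) ≤ C}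

/-- The quasiconvex hull `𝒳_C(φ)`: the union of all geodesic segments joining
pairs of points of the almost fixed set `F_C(φ)`. -/
def qcHull [MetricSpace X] (φ : X ≃ᵢ X) (C : ℝ) : Set X :=
  {y | ∃ p ∈ almostFixedSet φ C, ∃ q ∈ almostFixedSet φ C,
    ∃ s : Set X, IsGeodSegment s p q ∧ y ∈ s}

/-- `Y` is `c`-quasiconvex: every geodesic segment between points of `Y` lies in the
closed `c`-neighborhood of `Y`. -/
def IsQuasiconvexSet [MetricSpace X] (c : ℝ) (Y : Set X) : Prop :=
  ∀ p ∈ Y, ∀ q ∈ Y, ∀ s : Set X, IsGeodSegment s p q → ∀ y ∈ s, Metric.infDist y Y ≤ c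

section GromovHyperbolic

variable [MetricSpace X] {δ ε C : ℝ}

lemma gromovProd_swap (p x y : X) : gromovProd p x y = gromovProd p y x := by
  simp only [gromovProd, dist_comm x y]; ring

lemma gromovProd_map (g : X ≃ᵢ X) (p x y : X) :
    gromovProd (g p) (g x) (g y) = gromovProd p x y := by
  simp only [gromovProd, g.dist_eq]

lemma gromovProd_le_dist (p x y : X) : gromovProd p x y ≤ dist p x := by
  have := dist_triangle p x y
  simp only [gromovProd]; linarith

lemma gromovProd_add_gromovProd (p x y : X) :
    gromovProd p x y + gromovProd x p y = dist p x := by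
  simp only [gromovProd, dist_comm x p]; ring

lemma GeodesicParam.exists_dist_eq {γ : ℝ → X} {x y : X} (h : GeodesicParam γ x y) {t : ℝ}
    (ht : t ∈ Set.Icc 0 (dist x y)) :
    dist x (γ t) = t ∧ dist (γ t) y = dist x y - t := by
  obtain ⟨h0, h1, hd⟩ := h
  constructor
  · have := hd 0 ⟨le_rfl, dist_nonneg⟩ t ht
    rwa [h0, zero_sub, abs_neg, abs_of_nonneg ht.1] at this
  · have := hd t ht _ ⟨dist_nonneg, le_rfl⟩
    rwa [h1, abs_sub_comm, abs_of_nonneg (sub_nonneg.2 ht.2)] at this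

lemma IsGeodesicSpace.exists_between (hX : IsGeodesicSpace X) (x y : X) {t : ℝ}
    (ht : t ∈ Set.Icc 0 (dist x y)) : ∃ z, dist x z = t ∧ dist z y = dist x y - t := by
  obtain ⟨_, γ, hγ, _⟩ := hX x y
  exact ⟨γ t, hγ.exists_dist_eq ht⟩

lemma IsGromovHyperbolic.nonneg (hδ : IsGromovHyperbolic X δ) (x : X) : 0 ≤ δ := by
  simpa [gromovProd] using hδ x x x x

/-- In a hyperbolic space, a geodesic segment from `a` to `b` comes within `(a, b)_x + 2δ`
of the point `x`. -/
lemma IsGromovHyperbolic.exists_dist_le (hδ : IsGromovHyperbolic X δ) (x : X) {a b : X}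
    {s : Set X} (hs : IsGeodSegment s a b) : ∃ z ∈ s, dist x z ≤ gromovProd x a b + 2 * δ := by
  obtain ⟨γ, hγ, rfl⟩ := hs
  have ht : gromovProd a x b ∈ Set.Icc 0 (dist a b) := by
    have h1 := dist_triangle x a b
    have h2 := dist_triangle a b x
    have h3 := dist_triangle a x b
    simp only [gromovProd, Set.mem_Icc, dist_comm x a, dist_comm b x] at *
    constructor <;> linarith
  obtain ⟨h1, h2⟩ := hγ.exists_dist_eq ht
  refine ⟨_, Set.mem_image_of_mem _ ht, ?_⟩
  generalize γ (gromovProd a x b) = z at *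
  have := hδ z a b x
  rw [min_le_iff] at this
  simp only [gromovProd, dist_comm z a, dist_comm z x, dist_comm x a, dist_comm x b] at *
  rcases this with h | h <;> linarith

lemma almostFixedSet_subset_qcHull (hX : IsGeodesicSpace X) (φ : X ≃ᵢ X) :
    almostFixedSet φ C ⊆ qcHull φ C := by
  intro a ha
  obtain ⟨s, γ, hγ, rfl⟩ := hX a a
  exact ⟨a, ha, a, ha, _, ⟨γ, hγ, rfl⟩, 0, ⟨le_rfl, dist_nonneg⟩, hγ.1⟩

lemma zpow_apply_mem_almostFixedSet {φ : X ≃ᵢ X} {a : X} (ha : a ∈ almostFixedSet φ C) (n : ℤ) :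
    (φ ^ n) a ∈ almostFixedSet φ C := by
  obtain ⟨k, hk, h⟩ := ha
  refine ⟨k, hk, ?_⟩
  rwa [← IsometryEquiv.mul_apply, (Commute.zpow_zpow_self φ k n).eq, IsometryEquiv.mul_apply,
    (φ ^ n).dist_eq]

/-- If `p` lies on a geodesic from `a` to `b`, then `(p, a)_x ≥ (a, b)_x`. -/
lemma gromovProd_le_of_dist_add {a b p : X} (h : dist a p + dist p b = dist a b) (x : X) :
    gromovProd x a b ≤ gromovProd x p a := by
  have := dist_triangle x p b
  simp only [gromovProd, dist_comm p a] at *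
  linarith

/-- Translates of an almost nearest point `p` of the hull are aligned with `p` as seen from `x`. -/
lemma le_gromovProd_zpow_apply (hX : IsGeodesicSpace X) (hδ : IsGromovHyperbolic X δ)
    {φ : X ≃ᵢ X} {p x : X} (hp : p ∈ qcHull φ C) (hR : ∀ z ∈ qcHull φ C, dist x p - ε ≤ dist x z)
    (n : ℤ) : dist x p - ε - 4 * δ ≤ gromovProd x p ((φ ^ n) p) := by
  obtain ⟨a, ha, b, hb, s, ⟨γ, hγ, rfl⟩, t, ht, rfl⟩ := hp
  obtain ⟨h1, h2⟩ := hγ.exists_dist_eq ht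
  have hab : dist a (γ t) + dist (γ t) b = dist a b := by linarith
  generalize γ t = p at *
  have key : ∀ c ∈ almostFixedSet φ C, ∀ d ∈ almostFixedSet φ C,
      dist x p - ε - 2 * δ ≤ gromovProd x c d := by
    intro c hc d hd
    obtain ⟨s, hs⟩ := hX c d
    obtain ⟨z, hz, hxz⟩ := hδ.exists_dist_le x hs
    have := hR z ⟨c, hc, d, hd, s, hs, hz⟩
    linarith
  have hua := zpow_apply_mem_almostFixedSet ha n
  have hub := zpow_apply_mem_almostFixedSet hb n
  have e1 := (key a ha b hb).trans (gromovProd_le_of_dist_add hab x)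
  have e2 := (key _ hua _ hub).trans (gromovProd_le_of_dist_add (p := (φ ^ n) p)
    (by simpa only [(φ ^ n).dist_eq] using hab) x)
  have e3 := key a ha _ hua
  rw [gromovProd_swap] at e2
  have f1 := hδ x p ((φ ^ n) a) a
  have f2 := hδ x p ((φ ^ n) p) ((φ ^ n) a)
  have hd := hδ.nonneg x
  rcases min_le_iff.1 f1 with h | h <;> rcases min_le_iff.1 f2 with h' | h' <;> linarith

/-- Seen from a point `x` far from the hull of `φ`, all points `φⁿ x` with `n ≠ 0` lie behind
an almost nearest point `p` of the hull. -/
lemma le_gromovProd_zpow_apply_self (hX : IsGeodesicSpace X) (hδ : IsGromovHyperbolic X δ)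
    (hε : 0 < ε) (hC : 9 * δ + 6 * ε ≤ C) {φ : X ≃ᵢ X} {p x : X} (hp : p ∈ qcHull φ C)
    (hR : ∀ z ∈ qcHull φ C, dist x p - ε ≤ dist x z) (hxp : 2 * ε ≤ dist x p)
    {n : ℤ} (hn : n ≠ 0) :
    dist x p - 5 * δ - 5 * ε ≤ gromovProd x ((φ ^ n) x) p := by
  obtain ⟨y, hpy, hyx⟩ := hX.exists_between p x (t := 2 * ε)
    ⟨by positivity, by rwa [dist_comm]⟩
  have hyC : C < dist y ((φ ^ n) y) := by
    by_contra! h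
    have := hR y (almostFixedSet_subset_qcHull hX φ ⟨n, hn, h⟩)
    rw [dist_comm x y, hyx, dist_comm x p] at this
    linarith
  have key : ∀ k : ℤ, gromovProd y x ((φ ^ k) y) ≤ 4 * δ + 3 * ε := by
    intro k
    have h1 := le_gromovProd_zpow_apply hX hδ hp hR k
    have h2 := dist_triangle4 y p ((φ ^ k) p) ((φ ^ k) y)
    have h4 := (φ ^ k).dist_eq p y
    have h3 := dist_triangle x ((φ ^ k) y) ((φ ^ k) p)
    rw [dist_comm ((φ ^ k) y)] at h3
    simp only [gromovProd, dist_comm y p, dist_comm y x, dist_comm p x] at *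
    linarith
  have k1 := key n
  have k2 : gromovProd ((φ ^ n) y) y ((φ ^ n) x) ≤ 4 * δ + 3 * ε := by
    rw [gromovProd_swap]
    have := key (-n)
    rw [← gromovProd_map (φ ^ n), ← IsometryEquiv.mul_apply (φ ^ n) (φ ^ (-n))] at this
    simpa using this
  have h1 := gromovProd_add_gromovProd y ((φ ^ n) y) ((φ ^ n) x)
  have h2 : gromovProd y x ((φ ^ n) x) ≤ 5 * δ + 3 * ε := by
    have := hδ y x ((φ ^ n) y) ((φ ^ n) x)
    rw [gromovProd_swap y ((φ ^ n) x)] at this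
    rcases min_le_iff.1 this with h | h <;> linarith
  have h3 := dist_triangle ((φ ^ n) x) y p
  rw [dist_comm _ y] at h3
  simp only [gromovProd, dist_comm y p, dist_comm y x, dist_comm p x] at *
  linarith

/-- A broken geodesic with long pieces and small Gromov products at its vertices makes linear
progress. -/
lemma IsGromovHyperbolic.natCast_le_dist (hδ : IsGromovHyperbolic X δ) {x : ℕ → X}
    (hd : ∀ i, 6 * δ + 1 ≤ dist (x i) (x (i + 1)))
    (hg : ∀ i, gromovProd (x (i + 1)) (x i) (x (i + 2)) ≤ 2 * δ) (n : ℕ) :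
    n ≤ dist (x 0) (x n) := by
  have h0 := hδ.nonneg (x 0)
  have key : ∀ i, gromovProd (x i) (x 0) (x (i + 1)) ≤ 3 * δ := by
    intro i
    induction i with
    | zero => simp only [gromovProd, dist_self]; linarith
    | succ i ih =>
      have h1 := hδ (x (i + 1)) (x i) (x (i + 2)) (x 0)
      have h2 := gromovProd_add_gromovProd (x i) (x (i + 1)) (x 0)
      rw [gromovProd_swap (x i)] at h2
      have h3 := hd i
      have h4 := hg i
      rcases min_le_iff.1 h1 with h | h <;> linarith
  induction n with
  | zero => simp
  | succ n ih =>
    have h1 := key n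
    have h2 := hd n
    simp only [gromovProd, dist_comm (x n) (x 0)] at h1
    push_cast
    linarith

end GromovHyperbolic

section AlternatingWords

variable {G : Type*} [Group G]

/-- The product of the powers `a ^ n` and `b ^ n` spelled by a word in the letters
`(true, n)` and `(false, n)`. -/
def wordProd (f : Bool → G) (l : List (Bool × ℤ)) : G :=
  (l.map fun s => f s.1 ^ s.2).prod

/-- Up to conjugation, an element of a two-generator subgroup is a power of a generator or is
spelled by a nonempty cyclically alternating word with nonzero exponents. -/
lemma exists_alternating_conj {f : Bool → G} {w : G}
    (hw : w ∈ Subgroup.closure (Set.range f))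
    (hconj : ¬ ∃ g ∈ Subgroup.closure (Set.range f), ∃ i, ∃ n : ℤ, w = g * f i ^ n * g⁻¹) :
    ∃ g : G, ∃ k : ℕ, 0 < k ∧ ∃ s : ℕ → Bool × ℤ, (∀ i, s (i + k) = s i) ∧
      (∀ i, (s i).2 ≠ 0 ∧ (s i).1 ≠ (s (i + 1)).1) ∧
      w = g * wordProd f ((List.range k).map s) * g⁻¹ := by
  set H := Subgroup.closure (Set.range f)
  have hf : ∀ i (n : ℤ), f i ^ n ∈ H := fun i n =>
    H.zpow_mem (Subgroup.subset_closure ⟨i, rfl⟩) n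
  let S : Set (List (Bool × ℤ)) := {l | ∃ g ∈ H, w = g * wordProd f l * g⁻¹}
  have hrot : ∀ l ∈ S, ∀ i, l.rotate i ∈ S := by
    intro l hl i
    induction i with
    | zero => simpa using hl
    | succ i ih =>
      rw [← List.rotate_rotate]
      generalize l.rotate i = l' at ih
      cases l' with
      | nil => simpa using ih
      | cons a t =>
        obtain ⟨g, hg, h⟩ := ih
        refine ⟨g * f a.1 ^ a.2, H.mul_mem hg (hf _ _), ?_⟩
        rw [h]
        simp [wordProd]
        group
  have hne : ∃ l, l ∈ S := by
    have : ∃ l, w = wordProd f l := by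
      refine Subgroup.closure_induction (p := fun w _ => ∃ l, w = wordProd f l) ?_ ?_ ?_ ?_ hw
      · rintro _ ⟨i, rfl⟩
        exact ⟨[(i, 1)], by simp [wordProd]⟩
      · exact ⟨[], by simp [wordProd]⟩
      · rintro _ _ _ _ ⟨l, rfl⟩ ⟨l', rfl⟩
        exact ⟨l ++ l', by simp [wordProd]⟩
      · rintro _ _ ⟨l, rfl⟩
        refine ⟨(l.map fun s => (s.1, -s.2)).reverse, ?_⟩
        simp [wordProd, List.prod_inv_reverse, Function.comp_def]
    obtain ⟨l, rfl⟩ := this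
    exact ⟨l, 1, H.one_mem, by simp⟩
  obtain ⟨l, hl, hmin⟩ : ∃ l ∈ S, ∀ l' ∈ S, l.length ≤ l'.length := by
    obtain ⟨l, hl, h⟩ := (measure (List.length (α := Bool × ℤ))).wf.has_min S hne
    exact ⟨l, hl, fun l' hl' => not_lt.1 (h l' hl')⟩
  have hlen : 2 ≤ l.length := by
    obtain ⟨g, hg, h⟩ := hl
    rcases l with _ | ⟨a, _ | ⟨b, t⟩⟩
    · exact absurd ⟨g, hg, true, 0, by simpa [wordProd] using h⟩ hconj
    · exact absurd ⟨g, hg, a.1, a.2, by simpa [wordProd] using h⟩ hconj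
    · simp
  have halt : ∀ (l' : List (Bool × ℤ)) (h2 : 2 ≤ l'.length), l' ∈ S → l'.length = l.length →
      l'[0].2 ≠ 0 ∧ l'[0].1 ≠ l'[1].1 := by
    rintro (_ | ⟨⟨a, m⟩, _ | ⟨⟨b, n⟩, t⟩⟩) h2 ⟨g, hg, h⟩ hlt
    · simp at h2
    · simp at h2
    simp only [List.getElem_cons_zero, List.getElem_cons_succ]
    constructor
    · rintro rfl
      have := hmin ((b, n) :: t) ⟨g, hg, by simpa [wordProd] using h⟩
      simp at hlt this
      omega
    · rintro rfl
      have := hmin ((a, m + n) :: t) ⟨g, hg, by simpa [wordProd, zpow_add, mul_assoc] using h⟩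
      simp at hlt this
      omega
  have hpos : 0 < l.length := by omega
  let s : ℕ → Bool × ℤ := fun i => l[i % l.length]'(Nat.mod_lt _ hpos)
  obtain ⟨g, hg, h⟩ := hl
  refine ⟨g, l.length, hpos, s, fun i => by simp [s], fun i => ?_, ?_⟩
  · have hr := hrot l ⟨g, hg, h⟩ i
    have hrl : (l.rotate i).length = l.length := l.length_rotate i
    have h0 : (l.rotate i)[0]'(by omega) = s i := by
      simp [List.getElem_rotate, s]
    have h1 : (l.rotate i)[1]'(by omega) = s (i + 1) := by
      simp [List.getElem_rotate, s, add_comm]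
    rw [← h0, ← h1]
    exact halt _ (by omega) hr hrl
  · have : (List.range l.length).map s = l := by
      apply List.ext_getElem
      · simp
      · intro i h1 h2
        simp [s, Nat.mod_eq_of_lt h2]
    rw [this]
    exact h

lemma wordProd_range_succ (f : Bool → G) (s : ℕ → Bool × ℤ) (n : ℕ) :
    wordProd f ((List.range (n + 1)).map s) =
      wordProd f ((List.range n).map s) * f (s n).1 ^ (s n).2 := by
  simp [wordProd, List.range_succ]

lemma wordProd_range_mul (f : Bool → G) {s : ℕ → Bool × ℤ} {k : ℕ} (hs : ∀ i, s (i + k) = s i)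
    (n : ℕ) : wordProd f ((List.range (k * n)).map s) =
      wordProd f ((List.range k).map s) ^ n := by
  have hadd : ∀ i, wordProd f ((List.range (k + i)).map s) =
      wordProd f ((List.range k).map s) * wordProd f ((List.range i).map s) := by
    intro i
    induction i with
    | zero => simp [wordProd]
    | succ i ih =>
      rw [← add_assoc, wordProd_range_succ, wordProd_range_succ, ih, add_comm k i, hs, mul_assoc]
  induction n with
  | zero => simp [wordProd]
  | succ n ih => rw [mul_add, mul_one, add_comm, hadd, ih, pow_succ']

end AlternatingWords

/-- Ping-pong in a hyperbolic space: if distinct letters move `m` far and in different directions,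
then cyclically alternating words act loxodromically. -/
lemma dist_pow_apply_ge_of_pingPong [MetricSpace X] {δ : ℝ} (hδ : IsGromovHyperbolic X δ)
    {f : Bool → X ≃ᵢ X} {m : X}
    (hd : ∀ i (n : ℤ), n ≠ 0 → 6 * δ + 1 ≤ dist m ((f i ^ n) m))
    (hg : ∀ i j (n k : ℤ), i ≠ j → n ≠ 0 → k ≠ 0 →
      gromovProd m ((f i ^ n) m) ((f j ^ k) m) ≤ 2 * δ)
    {w : X ≃ᵢ X} (hw : w ∈ Subgroup.closure (Set.range f))
    (hconj : ¬ ∃ g ∈ Subgroup.closure (Set.range f), ∃ i, ∃ n : ℤ, w = g * f i ^ n * g⁻¹)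
    (x : X) : ∃ b ≥ (0 : ℝ), ∀ n : ℕ, n - b ≤ dist ((w ^ n) x) x := by
  obtain ⟨g, k, hk, s, hper, hs, hwg⟩ := exists_alternating_conj hw hconj
  refine ⟨2 * dist x (g m), by positivity, fun n => ?_⟩
  have hlin := hδ.natCast_le_dist (x := fun i => wordProd f ((List.range i).map s) m) ?_ ?_ (k * n)
  · have h1 : (w ^ n) (g m) = g (wordProd f ((List.range (k * n)).map s) m) := by
      rw [hwg, conj_pow, wordProd_range_mul f hper]
      simp [IsometryEquiv.mul_apply]
    have h2 : dist ((w ^ n) (g m)) (g m) =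
        dist (wordProd f ((List.range 0).map s) m) (wordProd f ((List.range (k * n)).map s) m) := by
      rw [h1, g.dist_eq, dist_comm]
      simp [wordProd]
    have h3 := dist_triangle4 ((w ^ n) (g m)) ((w ^ n) x) x (g m)
    rw [(w ^ n).dist_eq, dist_comm (g m) x] at h3
    have h4 : (n : ℝ) ≤ ((k * n : ℕ) : ℝ) := by
      exact_mod_cast Nat.le_mul_of_pos_left n hk
    linarith
  · intro i
    simp only [wordProd_range_succ, IsometryEquiv.mul_apply, IsometryEquiv.dist_eq]
    exact hd _ _ (hs i).1
  · intro i
    simp only [wordProd_range_succ, IsometryEquiv.mul_apply]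
    rw [gromovProd_map]
    have h := hg _ _ (-(s i).2) _ (hs i).2 (neg_ne_zero.2 (hs i).1) (hs (i + 1)).1
    rw [← gromovProd_map (f (s i).1 ^ (s i).2), ← IsometryEquiv.mul_apply, ← zpow_add,
      add_neg_cancel, zpow_zero] at h
    exact h

/-- under the same hypotheses as Statement 0, every element of the subgroup
generated by `φ₁, φ₂` that is not conjugate in that subgroup to a power of `φ₁` or `φ₂`
acts loxodromically on `X` (its orbits grow linearly). -/
theorem loxodromic_from_far_twists (δ C C' : ℝ) (hδ : 0 ≤ δ) (hC : 100 * δ < C)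
    (hC' : 0 ≤ C') :
    ∃ C₁ : ℝ, ∀ (X : Type*) [MetricSpace X],
      IsGeodesicSpace X → IsGromovHyperbolic X δ →
      ∀ φ₁ φ₂ : X ≃ᵢ X,
        (almostFixedSet φ₁ C).Nonempty → (almostFixedSet φ₂ C).Nonempty →
        Metric.diam (qcHull φ₁ C) ≤ C' → Metric.diam (qcHull φ₂ C) ≤ C' →
        C₁ ≤ setDist (qcHull φ₁ C) (qcHull φ₂ C) →
        ∀ w : X ≃ᵢ X, w ∈ Subgroup.closure {φ₁, φ₂} →
          (¬ ∃ g ∈ Subgroup.closure {φ₁, φ₂}, ∃ n : ℤ,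
              w = g * φ₁ ^ n * g⁻¹ ∨ w = g * φ₂ ^ n * g⁻¹) →
          ∀ x : X, ∃ a > (0 : ℝ), ∃ b ≥ (0 : ℝ), ∀ n : ℕ, 1 ≤ n →
            a * n - b ≤ dist ((w ^ n) x) x := by
  have hε : 0 < (C - 100 * δ) / 100 := by linarith
  obtain ⟨ε, hCε, hε⟩ : ∃ ε : ℝ, C = 100 * δ + 100 * ε ∧ 0 < ε := ⟨_, by ring, hε⟩
  refine ⟨22 * δ + 10 * ε + 2, ?_⟩
  intro X _ hX hhyp φ₁ φ₂ hF₁ hF₂ _ _ hfar w hw hconj x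
  set D := setDist (qcHull φ₁ C) (qcHull φ₂ C)
  have hDle : ∀ z₁ ∈ qcHull φ₁ C, ∀ z₂ ∈ qcHull φ₂ C, D ≤ dist z₁ z₂ := by
    intro z₁ h₁ z₂ h₂
    refine csInf_le ⟨0, ?_⟩ (Set.mem_image2_of_mem h₁ h₂)
    rintro _ ⟨a, _, b, _, rfl⟩
    exact dist_nonneg
  obtain ⟨_, ⟨p, hp, q, hq, rfl⟩, hpq⟩ := Real.lt_sInf_add_pos
    ((hF₁.mono (almostFixedSet_subset_qcHull hX φ₁)).image2
      (hF₂.mono (almostFixedSet_subset_qcHull hX φ₂)) (f := dist)) hε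
  change dist p q < D + ε at hpq
  have hDpq := hDle p hp q hq
  obtain ⟨m, hpm, hmq⟩ := hX.exists_between p q (t := dist p q / 2)
    ⟨by positivity, by linarith [dist_nonneg (x := p) (y := q)]⟩
  rw [dist_comm] at hpm
  have g₁ : ∀ n : ℤ, n ≠ 0 → 6 * δ + 1 ≤ gromovProd m ((φ₁ ^ n) m) p := by
    intro n hn
    have := le_gromovProd_zpow_apply_self hX hhyp hε (by linarith) hp (x := m) ?_ (by linarith) hn
    · linarith
    · intro z hz
      have h1 := hDle z hz q hq
      have h2 := dist_triangle z m q
      rw [dist_comm z m] at h2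
      linarith
  have g₂ : ∀ n : ℤ, n ≠ 0 → 6 * δ + 1 ≤ gromovProd m ((φ₂ ^ n) m) q := by
    intro n hn
    have := le_gromovProd_zpow_apply_self hX hhyp hε (by linarith) hq (x := m) ?_ (by linarith) hn
    · linarith
    · intro z hz
      have h1 := hDle p hp z hz
      have h2 := dist_triangle p m z
      rw [dist_comm p m] at h2
      linarith
  have hpq0 : gromovProd m p q = 0 := by
    simp only [gromovProd]; linarith
  have g₁₂ : ∀ n k : ℤ, n ≠ 0 → k ≠ 0 →
      gromovProd m ((φ₁ ^ n) m) ((φ₂ ^ k) m) ≤ 2 * δ := by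
    intro n k hn hk
    have h1 := g₁ n hn
    have h2 := g₂ k hk
    have h3 := hhyp m p q ((φ₁ ^ n) m)
    have h4 := hhyp m ((φ₁ ^ n) m) q ((φ₂ ^ k) m)
    rw [gromovProd_swap m p] at h3
    rcases min_le_iff.1 h3 with h | h <;> rcases min_le_iff.1 h4 with h' | h' <;> linarith
  have hrange : Set.range (fun i => bif i then φ₁ else φ₂) = {φ₁, φ₂} := by
    ext; simp [eq_comm, or_comm]
  have hd : ∀ (i : Bool) (n : ℤ), n ≠ 0 →
      6 * δ + 1 ≤ dist m (((bif i then φ₁ else φ₂) ^ n) m) := by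
    rintro (_ | _) n hn
    · exact (g₂ n hn).trans (gromovProd_le_dist _ _ _)
    · exact (g₁ n hn).trans (gromovProd_le_dist _ _ _)
  have hg : ∀ (i j : Bool) (n k : ℤ), i ≠ j → n ≠ 0 → k ≠ 0 →
      gromovProd m (((bif i then φ₁ else φ₂) ^ n) m) (((bif j then φ₁ else φ₂) ^ k) m)
        ≤ 2 * δ := by
    rintro (_ | _) (_ | _) n k hij hn hk
    · simp at hij
    · rw [gromovProd_swap]
      exact g₁₂ k n hk hn
    · exact g₁₂ n k hn hk
    · simp at hij
  rw [← hrange] at hw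
  obtain ⟨b, hb, h⟩ := dist_pow_apply_ge_of_pingPong hhyp hd hg hw (by
    rw [hrange]
    rintro ⟨g, hg, (_ | _), n, h⟩
    · exact hconj ⟨g, hg, n, Or.inr h⟩
    · exact hconj ⟨g, hg, n, Or.inl h⟩) x
  exact ⟨1, one_pos, b, hb, fun n _ => by simpa using h n⟩
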